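/- Let M₀ > 0 and let c be a real number with 0 ≤ c ≤ 3M₀², and set L = 3M₀². Then the truncated potential and nonlinearity satisfy, for all u, v ∈ ℝ, F̃(u) − F̃(v) ≤ f̃(v)(u − v) + (L/2)(u − v)². -/

import Mathlib

/-- The truncated nonlinearity `f̃`, equal to `φ³ − cφ` on `[−M₀, M₀]` and
extended linearly (with slope `3M₀² − c`) outside this interval. -/
noncomputable def ftil (M₀ c : ℝ) (φ : ℝ) : ℝ :=
  if φ > M₀ then (3 * M₀ ^ 2 - c) * φ - 2 * M₀ ^ 3
  else if φ < -M₀ then (3 * M₀ ^ 2 - c) * φ + 2 * M₀ ^ 3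
  else φ ^ 3 - c * φ

/-- The truncated potential `F̃`, equal to `(1/4)φ⁴ − (c/2)φ²` on
`[−M₀, M₀]` and extended quadratically outside this interval. -/
noncomputable def Ftil (M₀ c : ℝ) (φ : ℝ) : ℝ :=
  if φ > M₀ then (3 * M₀ ^ 2 - c) / 2 * φ ^ 2 - 2 * M₀ ^ 3 * φ + 3 / 4 * M₀ ^ 4
  else if φ < -M₀ then (3 * M₀ ^ 2 - c) / 2 * φ ^ 2 + 2 * M₀ ^ 3 * φ + 3 / 4 * M₀ ^ 4
  else 1 / 4 * φ ^ 4 - c / 2 * φ ^ 2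

/-- With `L = 3M₀²`, the truncated potential and nonlinearity satisfy the
one-sided Taylor bound `F̃(u) − F̃(v) ≤ f̃(v)(u − v) + (L/2)(u − v)²`
for all `u, v ∈ ℝ`, provided `M₀ > 0` and `0 ≤ c ≤ 3M₀²`. -/
theorem Ftil_taylor_bound
    (M₀ c : ℝ) (hM : 0 < M₀) (hc0 : 0 ≤ c) (hc1 : c ≤ 3 * M₀ ^ 2) :
    ∀ u v : ℝ, Ftil M₀ c u - Ftil M₀ c v
      ≤ ftil M₀ c v * (u - v) + 3 * M₀ ^ 2 / 2 * (u - v) ^ 2 := by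
  intro u v
  have hc : 0 ≤ c * (u - v) ^ 2 := mul_nonneg hc0 (sq_nonneg _)
  have hM3 : 0 < M₀ ^ 3 := pow_pos hM 3
  have tangent_right : ∀ x, -M₀ ≤ x → x ≤ M₀ → 0 ≤ (M₀ - x) ^ 3 * (x + 3 * M₀) :=
    fun x h₁ h₂ => mul_nonneg (pow_nonneg (by linarith) 3) (by linarith)
  have tangent_left : ∀ x, -M₀ ≤ x → x ≤ M₀ → 0 ≤ (M₀ + x) ^ 3 * (3 * M₀ - x) :=
    fun x h₁ h₂ => mul_nonneg (pow_nonneg (by linarith) 3) (by linarith)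
  have inner_bound : ∀ x y, -M₀ ≤ x → x ≤ M₀ → -M₀ ≤ y → y ≤ M₀ →
      0 ≤ (x - y) ^ 2 * (6 * M₀ ^ 2 - (x ^ 2 + 2 * x * y + 3 * y ^ 2)) := by
    intro x y hx₁ hx₂ hy₁ hy₂
    have hx : x ^ 2 ≤ M₀ ^ 2 := sq_le_sq' hx₁ hx₂
    have hy : y ^ 2 ≤ M₀ ^ 2 := sq_le_sq' hy₁ hy₂
    exact mul_nonneg (sq_nonneg _) (by nlinarith [sq_nonneg (x - y)])
  unfold Ftil ftil
  split_ifs with hu hv hv' hu' hv hv' hv hv'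
  · linarith
  · nlinarith [mul_pos hM3 (hM.trans hu)]
  · have hslope : 0 ≤ (u - M₀) * ((M₀ - v) ^ 2 * (2 * M₀ + v)) :=
      mul_nonneg (by linarith) (mul_nonneg (sq_nonneg _) (by linarith))
    linarith [inner_bound M₀ v (by linarith) le_rfl (by linarith) (by linarith)]
  · nlinarith [mul_pos hM3 (show 0 < -u by linarith)]
  · linarith
  · have hslope : 0 ≤ (-M₀ - u) * ((M₀ + v) ^ 2 * (2 * M₀ - v)) :=
      mul_nonneg (by linarith) (mul_nonneg (sq_nonneg _) (by linarith))
    linarith [inner_bound (-M₀) v le_rfl (by linarith) (by linarith) (by linarith)]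
  · linarith [tangent_right u (by linarith) (by linarith)]
  · linarith [tangent_left u (by linarith) (by linarith)]
  · linarith [inner_bound u v (by linarith) (by linarith) (by linarith) (by linarith)]
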